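/- Theorem (slow convergence of Rational Pavlov for small p). There exist constants p₁ > 0 and c > 0 such that for every p ∈ (0, p₁] and every sufficiently large n (in particular n ≥ e^{1/p}): if the RP chain is started from the all-defect configuration, then the probability that S_t equals the all-cooperate configuration for some t ≤ e^{c·n} is at most e^{−c·n}. -/

import Mathlib

open scoped Classical

/-- A configuration of the `n`-cycle: `true` = cooperate, `false` = defect. -/
abbrev Config (n : ℕ) := ZMod n → Bool

/-- Probability that, when the edge `{i, i+1}` is selected for play, the
Rational Pavlov update turns configuration `S` into configuration `T`. -/
noncomputable def rpUpdProb (p : ℝ) {n : ℕ} (S : Config n) (i : ZMod n) (T : Config n) : ℝ :=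
  if S i = true ∧ S (i + 1) = true then
    (if T = S then 1 else 0)
  else if S i = false ∧ S (i + 1) = false then
    (if ∀ j : ZMod n, j ≠ i → j ≠ i + 1 → T j = S j then
      (if T i = true then p else 1 - p) * (if T (i + 1) = true then p else 1 - p)
    else 0)
  else
    (if T = Function.update (Function.update S i false) (i + 1) false then 1 else 0)

/-- One-step transition probability of the Rational Pavlov chain on the `n`-cycle:
an edge `{i, i+1}` is chosen uniformly at random and the two players update. -/
noncomputable def rpStepProb (p : ℝ) {n : ℕ} [NeZero n] (S T : Config n) : ℝ :=
  (1 / (n : ℝ)) * ∑ i : ZMod n, rpUpdProb p S i T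

/-- Probability that the Rational Pavlov chain started at `S0`, run for `t` steps,
produces a trajectory `σ : Fin (t+1) → Config n` satisfying the event `E`. -/
noncomputable def rpTrajProb (p : ℝ) {n : ℕ} [NeZero n] (S0 : Config n) (t : ℕ)
    (E : (Fin (t + 1) → Config n) → Prop) : ℝ :=
  ∑ σ : Fin (t + 1) → Config n,
    (if σ 0 = S0 ∧ E σ then ∏ s : Fin t, rpStepProb p (σ s.castSucc) (σ s.succ) else 0)

/-! ### Action of a single edge update on functions -/

/-- Expected value of `f` after an update of the edge `{e, e + 1}`. -/
noncomputable def edgeOp (p : ℝ) {n : ℕ} [NeZero n] (e : ZMod n) (f : Config n → ℝ)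
    (S : Config n) : ℝ :=
  ∑ T : Config n, rpUpdProb p S e T * f T

theorem edgeOp_of_cooperate (p : ℝ) {n : ℕ} [NeZero n] {e : ZMod n} (f : Config n → ℝ)
    {S : Config n} (h : S e = true ∧ S (e + 1) = true) : edgeOp p e f S = f S := by
  simp [edgeOp, rpUpdProb, h]

theorem edgeOp_of_mixed (p : ℝ) {n : ℕ} [NeZero n] {e : ZMod n} (f : Config n → ℝ)
    {S : Config n} (h₁ : ¬(S e = true ∧ S (e + 1) = true))
    (h₂ : ¬(S e = false ∧ S (e + 1) = false)) :
    edgeOp p e f S = f (Function.update (Function.update S e false) (e + 1) false) := by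
  unfold edgeOp rpUpdProb
  simp only [if_neg h₁, if_neg h₂, ite_mul, one_mul, zero_mul]
  simp

theorem edgeOp_of_defect (p : ℝ) {n : ℕ} [NeZero n] {e : ZMod n} (he : e ≠ e + 1)
    (f : Config n → ℝ) {S : Config n} (h : S e = false ∧ S (e + 1) = false) :
    edgeOp p e f S = ∑ b : Bool × Bool, (if b.1 = true then p else 1 - p) *
      (if b.2 = true then p else 1 - p) *
        f (Function.update (Function.update S e b.1) (e + 1) b.2) := by
  have h₁ : ¬(S e = true ∧ S (e + 1) = true) := by simp [h]
  unfold edgeOp rpUpdProb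
  simp only [if_neg h₁, if_pos h]
  symm
  refine Finset.sum_of_injOn
    (fun b : Bool × Bool => Function.update (Function.update S e b.1) (e + 1) b.2)
    ?_ (by intro _ _; simp) ?_ ?_
  · rintro ⟨a, b⟩ _ ⟨c, d⟩ _ hh
    have h3 := congrFun hh e
    have h4 := congrFun hh (e + 1)
    simp [Function.update_of_ne he] at h3 h4
    simp [h3, h4]
  · intro T _ hT
    rw [if_neg, zero_mul]
    intro hag
    apply hT
    refine ⟨(T e, T (e + 1)), by simp, ?_⟩
    funext j
    by_cases hj : j = e + 1
    · subst hj; simp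
    · by_cases hj' : j = e
      · subst hj'; simp [Function.update_of_ne he]
      · simp [Function.update_of_ne hj, Function.update_of_ne hj', hag j hj' hj]
  · rintro ⟨b, c⟩ _
    have hag : ∀ j : ZMod n, j ≠ e → j ≠ e + 1 →
        Function.update (Function.update S e b) (e + 1) c j = S j := by
      intro j hj hj'
      simp [Function.update_of_ne hj, Function.update_of_ne hj']
    simp only [if_pos hag, Function.update_self, Function.update_of_ne he]

/-! ### Families of arcs lying in distinct cooperating runs -/

/-- The arcs `{a j, …, a j + l j - 1}`, `j ∈ J`, consist of cooperators of `S` and lie in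
pairwise distinct maximal runs of cooperators, and `S` is not the all-cooperate configuration.
Distinctness of runs is witnessed by a colouring that is constant on runs. -/
def InDistinctRuns {n : ℕ} (J : Finset ℕ) (a : ℕ → ZMod n) (l : ℕ → ℕ) (S : Config n) : Prop :=
  S ≠ (fun _ => true) ∧ ∃ φ : ZMod n → ℕ,
    (∀ x, S x = true → S (x + 1) = true → φ x = φ (x + 1)) ∧
    ∀ j ∈ J, ∀ i < l j, S (a j + i) = true ∧ φ (a j + i) = j

/-- The edge `{e, e + 1}` meets the arc of length `l` starting at `a`. -/
def Meets {n : ℕ} (a : ZMod n) (l : ℕ) (e : ZMod n) : Prop :=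
  0 < l ∧ (e + 1 - a).val ≤ l

section DistinctRuns

variable {n : ℕ}

theorem natCast_add_inj [NeZero n] {a : ZMod n} {s t : ℕ} (hs : s < n) (ht : t < n)
    (h : a + (s : ZMod n) = a + t) : s = t := by
  have h' : (s : ZMod n) = t := add_left_cancel h
  have := congrArg ZMod.val h'
  rwa [ZMod.val_natCast_of_lt hs, ZMod.val_natCast_of_lt ht] at this

theorem eq_add_val [NeZero n] (a x : ZMod n) : x = a + ((x - a).val : ZMod n) := by
  simp

/-- An edge meeting an arc contains one of its sites. -/
theorem Meets.exists_mem [NeZero n] {a : ZMod n} {l : ℕ} {e : ZMod n} (h : Meets a l e) :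
    ∃ i < l, a + (i : ZMod n) = e ∨ a + (i : ZMod n) = e + 1 := by
  obtain ⟨hl, hi⟩ := h
  have hx := eq_add_val a (e + 1)
  generalize (e + 1 - a).val = i at hi hx
  rcases i with _ | i
  · exact ⟨0, hl, Or.inr hx.symm⟩
  · refine ⟨i, by omega, Or.inl ?_⟩
    push_cast at hx
    rw [← add_assoc] at hx
    exact (add_right_cancel hx).symm

theorem meets_of_mem [NeZero n] {a : ZMod n} {l : ℕ} (hl : l < n) {e : ZMod n} {i : ℕ} (hi : i < l)
    (h : a + (i : ZMod n) = e ∨ a + (i : ZMod n) = e + 1) : Meets a l e := by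
  refine ⟨by omega, ?_⟩
  rcases h with h | h
  · have : e + 1 - a = ((i + 1 : ℕ) : ZMod n) := by rw [← h]; push_cast; ring
    rw [this, ZMod.val_natCast_of_lt (by omega)]; omega
  · have : e + 1 - a = (i : ZMod n) := by rw [← h]; ring
    rw [this, ZMod.val_natCast_of_lt (by omega)]; omega

theorem InDistinctRuns.length_lt [NeZero n] {J : Finset ℕ} {a : ℕ → ZMod n} {l : ℕ → ℕ}
    {S : Config n} (h : InDistinctRuns J a l S) {j : ℕ} (hj : j ∈ J) : l j < n := by
  obtain ⟨hS, φ, -, hφ⟩ := h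
  by_contra hl
  apply hS
  funext x
  rw [eq_add_val (a j) x]
  exact (hφ j hj _ (lt_of_lt_of_le (ZMod.val_lt _) (not_lt.mp hl))).1

/-- Two arcs in distinct runs cannot both meet the same edge. -/
theorem InDistinctRuns.eq_of_meets [NeZero n] {J : Finset ℕ} {a : ℕ → ZMod n} {l : ℕ → ℕ}
    {S : Config n} (h : InDistinctRuns J a l S) {j k : ℕ} (hj : j ∈ J) (hk : k ∈ J) {e : ZMod n}
    (hje : Meets (a j) (l j) e) (hke : Meets (a k) (l k) e) : j = k := by
  obtain ⟨-, φ, hφ, hA⟩ := h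
  obtain ⟨i, hi, hie⟩ := hje.exists_mem
  obtain ⟨i', hi', hie'⟩ := hke.exists_mem
  have h1 := hA j hj i hi
  have h2 := hA k hk i' hi'
  have := hφ e
  rcases hie with hie | hie <;> rcases hie' with hie' | hie' <;> rw [hie] at h1 <;>
    rw [hie'] at h2 <;> grind

/-- A defecting edge that meets no arc may have been created from anything. -/
theorem InDistinctRuns.of_defect {J : Finset ℕ} {a : ℕ → ZMod n} {l : ℕ → ℕ}
    {S T : Config n} {e : ZMod n} (hT : InDistinctRuns J a l T)
    (hag : ∀ x, x ≠ e → x ≠ e + 1 → T x = S x) (he : S e = false) (he' : S (e + 1) = false)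
    (hJ : ∀ j ∈ J, ∀ i < l j, ¬(a j + (i : ZMod n) = e ∨ a j + (i : ZMod n) = e + 1)) :
    InDistinctRuns J a l S := by
  obtain ⟨-, φ, hφ, hA⟩ := hT
  refine ⟨fun h => by simp [h] at he, φ, ?_, ?_⟩
  · intro x hx hx'
    have h1 : x ≠ e := fun h => by simp [h, he] at hx
    have h2 : x ≠ e + 1 := fun h => by simp [h, he'] at hx
    have h3 : x + 1 ≠ e := fun h => by simp [h, he] at hx'
    have h4 : x + 1 ≠ e + 1 := fun h => by simp [h, he'] at hx'
    exact hφ x (by rw [hag x h1 h2, hx]) (by rw [hag _ h3 h4, hx'])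
  · intro j hj i hi
    have := hJ j hj i hi
    push Not at this
    rw [← hag _ this.1 this.2]
    exact hA j hj i hi

/-- Runs of cooperators never split when a mixed edge is updated. -/
theorem InDistinctRuns.of_mixed [NeZero n] {J : Finset ℕ} {a : ℕ → ZMod n}
    {l : ℕ → ℕ} {S : Config n} {e : ZMod n} (hne : e ≠ e + 1)
    (hT : InDistinctRuns J a l (Function.update (Function.update S e false) (e + 1) false))
    (h₁ : ¬(S e = true ∧ S (e + 1) = true)) :
    InDistinctRuns J a l S := by
  obtain ⟨-, φ, hφ, hA⟩ := hT
  have hxx : ∀ x : ZMod n, x ≠ x + 1 := by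
    intro x hx
    apply hne
    have : (1 : ZMod n) = 0 := by simpa using hx.symm
    simp [this]
  have hT' : ∀ x, x ≠ e → x ≠ e + 1 →
      Function.update (Function.update S e false) (e + 1) false x = S x := by
    intro x hx hx'
    simp [Function.update_of_ne hx, Function.update_of_ne hx']
  have hTe : Function.update (Function.update S e false) (e + 1) false e = false := by
    simp [Function.update_of_ne hne]
  have hTe' : Function.update (Function.update S e false) (e + 1) false (e + 1) = false := by
    simp
  generalize Function.update (Function.update S e false) (e + 1) false = T at *
  refine ⟨fun h => by simp [h] at h₁, fun x => if x = e then φ (e - 1) else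
    if x = e + 1 then φ (e + 1 + 1) else φ x, ?_, ?_⟩
  · intro x hx hx'
    have h1 := hxx x
    have h2 := hxx (e - 1)
    have h3 := hxx e
    have h4 := hxx (e + 1)
    have h5 : ∀ y : ZMod n, y + 1 = e ↔ y = e - 1 := fun y => eq_sub_iff_add_eq.symm
    have h6 : ∀ y : ZMod n, y + 1 = e + 1 ↔ y = e := fun y => add_left_inj 1
    have h7 := hφ x
    have h8 := hT' x
    have h9 := hT' (x + 1)
    dsimp only
    grind
  · intro j hj i hi
    obtain ⟨h1, h2⟩ := hA j hj i hi
    have h3 : a j + (i : ZMod n) ≠ e := fun h => by simp [h, hTe] at h1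
    have h4 : a j + (i : ZMod n) ≠ e + 1 := fun h => by simp [h, hTe'] at h1
    rw [← hT' _ h3 h4]
    simp [h1, h2, h3, h4]

/-- A cooperating edge at the left end of an arc extends the arc. -/
theorem InDistinctRuns.extend_left {J : Finset ℕ} {a : ℕ → ZMod n} {l : ℕ → ℕ} {S : Config n}
    (hS : InDistinctRuns J a l S) {e : ZMod n} (h : S e = true ∧ S (e + 1) = true) {j : ℕ}
    (hj : j ∈ J) (hl : 0 < l j) (he : e + 1 = a j) :
    InDistinctRuns J (Function.update a j e) (Function.update l j (l j + 1)) S := by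
  obtain ⟨h0, φ, hφ, hA⟩ := hS
  refine ⟨h0, φ, hφ, ?_⟩
  intro k hk i hi
  by_cases hkj : k = j
  · subst hkj
    simp only [Function.update_self] at hi ⊢
    rcases i with _ | i
    · have := hA k hk 0 hl
      rw [Nat.cast_zero, add_zero, ← he] at this
      simp only [Nat.cast_zero, add_zero]
      exact ⟨h.1, (hφ e h.1 h.2).trans this.2⟩
    · have := hA k hk i (by omega)
      rw [← he] at this
      convert this using 3 <;> push_cast <;> ring_nf
  · simp only [Function.update_of_ne hkj] at hi ⊢
    exact hA k hk i hi

/-- A cooperating edge at the right end of an arc extends the arc. -/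
theorem InDistinctRuns.extend_right {J : Finset ℕ} {a : ℕ → ZMod n} {l : ℕ → ℕ} {S : Config n}
    (hS : InDistinctRuns J a l S) {e : ZMod n} (h : S e = true ∧ S (e + 1) = true) {j : ℕ}
    (hj : j ∈ J) (hl : 0 < l j) (he : e + 1 = a j + (l j : ZMod n)) :
    InDistinctRuns J a (Function.update l j (l j + 1)) S := by
  obtain ⟨h0, φ, hφ, hA⟩ := hS
  refine ⟨h0, φ, hφ, ?_⟩
  intro k hk i hi
  by_cases hkj : k = j
  · subst hkj
    simp only [Function.update_self] at hi
    rcases Nat.lt_succ_iff_lt_or_eq.mp hi with hi | rfl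
    · exact hA k hk i hi
    · have hA' := hA k hk (l k - 1) (by omega)
      have : a k + ((l k - 1 : ℕ) : ZMod n) = e := by
        rw [Nat.cast_sub hl]
        push_cast
        linear_combination -he
      rw [this] at hA'
      rw [← he]
      exact ⟨h.2, (hφ e h.1 h.2).symm.trans hA'.2⟩
  · simp only [Function.update_of_ne hkj] at hi
    exact hA k hk i hi

/-- Undoing the creation of cooperators on an edge that meets an arc removes the edge from the
arc; the two remaining pieces lie in distinct runs, and the right one gets the new index `m`. -/
theorem InDistinctRuns.split [NeZero n] {J : Finset ℕ} {a : ℕ → ZMod n} {l : ℕ → ℕ}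
    {S T : Config n} {e : ZMod n} (hT : InDistinctRuns J a l T)
    (hag : ∀ x, x ≠ e → x ≠ e + 1 → T x = S x) (he : S e = false) (he' : S (e + 1) = false)
    {j : ℕ} (hj : j ∈ J) {i : ℕ} (hl : 0 < l j) (hi : i ≤ l j)
    (hei : e + 1 = a j + (i : ZMod n)) {m : ℕ} (hm : m ∉ J) :
    InDistinctRuns (insert m J) (Function.update a m (a j + i + 1))
      (Function.update (Function.update l j (i - 1)) m (l j - 1 - i)) S := by
  have hln := hT.length_lt hj
  have huniq := fun k (hk : k ∈ J) h => hT.eq_of_meets (e := e) hj hk h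
  have hmeet : Meets (a j) (l j) e := by
    refine ⟨hl, ?_⟩
    rw [hei, add_sub_cancel_left, ZMod.val_natCast_of_lt (by omega)]
    exact hi
  have hlt := fun k (hk : k ∈ J) => hT.length_lt hk
  obtain ⟨h0, φ, hφ, hA⟩ := hT
  obtain ⟨y, hy⟩ : ∃ y, T y = false := by
    by_contra hcon
    push Not at hcon
    exact h0 (funext fun x => by simpa using hcon x)
  have hSy : S y = false := by
    by_cases h1 : y = e
    · rw [h1, he]
    · by_cases h2 : y = e + 1
      · rw [h2, he']
      · rw [← hag y h1 h2, hy]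
  have hyval := eq_add_val (e + 1) y
  have hdn : (y - (e + 1)).val < n := ZMod.val_lt _
  have hmj : m ≠ j := fun h => hm (h ▸ hj)
  refine ⟨fun h => by simp [h] at he,
    fun w => if (w - (e + 1)).val ≤ (y - (e + 1)).val ∧ φ w = j then m else φ w, ?_, ?_⟩
  · intro x hx hx'
    have hxe : x ≠ e := fun h => by simp [h, he] at hx
    have hxe' : x ≠ e + 1 := fun h => by simp [h, he'] at hx
    have hxe2 : x + 1 ≠ e := fun h => by simp [h, he] at hx'
    have hxe3 : x + 1 ≠ e + 1 := fun h => by simp [h, he'] at hx'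
    have hxy : x ≠ y := fun h => by simp [h, hSy] at hx
    have hφx := hφ x (by rw [hag x hxe hxe', hx]) (by rw [hag _ hxe2 hxe3, hx'])
    have hr : (x + 1 - (e + 1)).val = (x - (e + 1)).val + 1 := by
      have h1 : x + 1 - (e + 1) = (((x - (e + 1)).val + 1 : ℕ) : ZMod n) := by
        push_cast; simp; ring
      have h2 : (x - (e + 1)).val + 1 < n := by
        refine lt_of_le_of_ne (ZMod.val_lt _) fun h => hxe3 ?_
        rw [h, ZMod.natCast_self] at h1
        exact sub_eq_zero.mp h1
      rw [h1, ZMod.val_natCast_of_lt h2]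
    have hne : (x - (e + 1)).val ≠ (y - (e + 1)).val := fun h =>
      hxy (sub_left_injective (ZMod.val_injective n h))
    dsimp only
    rw [hr, ← hφx]
    have : (x - (e + 1)).val ≤ (y - (e + 1)).val ↔
      (x - (e + 1)).val + 1 ≤ (y - (e + 1)).val := by omega
    simp only [this]
  · generalize hd : (y - (e + 1)).val = d at *
    have hyarc : ∀ s : ℕ, s < l j → y ≠ a j + (s : ZMod n) := by
      intro s hs hys
      have := (hA j hj s hs).1
      rw [← hys, hy] at this
      exact absurd this (by simp)
    have hy' : y = a j + ((i + d : ℕ) : ZMod n) := by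
      rw [hyval, hei]; push_cast; ring
    intro k hk s hs
    rcases Finset.mem_insert.mp hk with rfl | hkJ
    · simp only [Function.update_self] at hs ⊢
      have hsite : a j + (i : ZMod n) + 1 + s = a j + ((i + 1 + s : ℕ) : ZMod n) := by
        push_cast; ring
      have hv : (a j + (i : ZMod n) + 1 + s - (e + 1)).val = s + 1 := by
        have : a j + (i : ZMod n) + 1 + s - (e + 1) = ((s + 1 : ℕ) : ZMod n) := by
          rw [hei]; push_cast; ring
        rw [this, ZMod.val_natCast_of_lt (by omega)]
      obtain ⟨h1, h2⟩ := hA j hj (i + 1 + s) (by omega)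
      rw [← hsite] at h1 h2
      have hne1 : a j + (i : ZMod n) + 1 + s ≠ e + 1 := by
        intro h
        rw [h, sub_self, ZMod.val_zero] at hv
        omega
      have hne2 : a j + (i : ZMod n) + 1 + s ≠ e := by
        intro h
        have h3 : e + 1 + ((s + 2 : ℕ) : ZMod n) = e + 1 + ((0 : ℕ) : ZMod n) := by
          push_cast
          linear_combination h + hei
        have := natCast_add_inj (by omega) (by omega) h3
        omega
      rw [← hag _ hne2 hne1, h1, hv, h2]
      refine ⟨rfl, if_pos ⟨?_, rfl⟩⟩
      by_contra hcon
      exact hyarc (i + d) (by omega) hy'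
    · have hkm : k ≠ m := fun h => hm (h ▸ hkJ)
      simp only [Function.update_of_ne hkm] at hs ⊢
      by_cases hkj : k = j
      · subst hkj
        simp only [Function.update_self] at hs
        obtain ⟨h1, h2⟩ := hA k hkJ s (by omega)
        have hne1 : a k + (s : ZMod n) ≠ e + 1 := by
          rw [hei]
          intro h
          have := natCast_add_inj (by omega) (by omega) h
          omega
        have hne2 : a k + (s : ZMod n) ≠ e := by
          intro h
          have h3 : a k + ((s + 1 : ℕ) : ZMod n) = a k + (i : ZMod n) := by
            rw [← hei, ← h]; push_cast; ring
          have := natCast_add_inj (by omega) (by omega) h3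
          omega
        have hv : (a k + (s : ZMod n) - (e + 1)).val = n + s - i := by
          have : a k + (s : ZMod n) - (e + 1) = ((n + s - i : ℕ) : ZMod n) := by
            rw [hei, Nat.cast_sub (by omega)]; push_cast; simp
          rw [this, ZMod.val_natCast_of_lt (by omega)]
        rw [← hag _ hne2 hne1, h1, h2, hv]
        refine ⟨rfl, if_neg ?_⟩
        rintro ⟨hle, -⟩
        refine hyarc (i + d - n) (by omega) ?_
        rw [hy', Nat.cast_sub (by omega)]
        simp
      · simp only [Function.update_of_ne hkj] at hs
        obtain ⟨h1, h2⟩ := hA k hkJ s hs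
        have hnm : ¬(a k + (s : ZMod n) = e ∨ a k + (s : ZMod n) = e + 1) := fun h =>
          hkj (huniq k hkJ hmeet (meets_of_mem (hlt k hkJ) hs h)).symm
        push Not at hnm
        rw [← hag _ hnm.1 hnm.2, h1, h2]
        exact ⟨rfl, if_neg fun h => hkj h.2⟩

/-! ### The weight of an arc -/

/-- The bound on the probability that an arc of length `k` consists of cooperators. -/
noncomputable def arcWeight (k : ℕ) : ℝ := catalan k * (1 / 32) ^ k

theorem catalan_pos (k : ℕ) : 0 < catalan k := by
  have h := succ_mul_catalan_eq_centralBinom k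
  have := Nat.centralBinom_pos k
  by_contra hc
  simp only [not_lt, nonpos_iff_eq_zero] at hc
  rw [hc, mul_zero] at h
  omega

theorem catalan_succ_le (k : ℕ) : catalan (k + 1) ≤ 4 * catalan k := by
  have h1 := succ_mul_catalan_eq_centralBinom k
  have h2 := succ_mul_catalan_eq_centralBinom (k + 1)
  have h3 := Nat.succ_mul_centralBinom_succ k
  rw [← h1, ← h2] at h3
  have h4 : (k + 1) * ((k + 2) * catalan (k + 1)) = (k + 1) * (2 * (2 * k + 1) * catalan k) := by
    linarith
  have h5 := Nat.eq_of_mul_eq_mul_left (Nat.succ_pos k) h4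
  have h6 : (k + 2) * catalan (k + 1) ≤ (k + 2) * (4 * catalan k) := by nlinarith
  exact Nat.le_of_mul_le_mul_left h6 (by omega)

theorem catalan_le_succ (k : ℕ) : catalan k ≤ catalan (k + 1) := by
  rw [catalan_succ]
  refine le_trans ?_ (Finset.single_le_sum (f := fun i : Fin k.succ => catalan i * catalan (k - i))
    (fun _ _ => Nat.zero_le _) (Finset.mem_univ 0))
  simp

theorem arcWeight_zero : arcWeight 0 = 1 := by simp [arcWeight]

theorem arcWeight_pos (k : ℕ) : 0 < arcWeight k := by
  have := catalan_pos k
  unfold arcWeight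
  positivity

theorem arcWeight_succ_le (k : ℕ) : arcWeight (k + 1) ≤ 1 / 8 * arcWeight k := by
  have h : (catalan (k + 1) : ℝ) ≤ 4 * catalan k := by exact_mod_cast catalan_succ_le k
  unfold arcWeight
  have : (0 : ℝ) < (1 / 32) ^ k := by positivity
  rw [pow_succ]
  nlinarith

theorem arcWeight_le_succ (k : ℕ) : arcWeight k ≤ 32 * arcWeight (k + 1) := by
  have h : (catalan k : ℝ) ≤ catalan (k + 1) := by exact_mod_cast catalan_le_succ k
  unfold arcWeight
  have : (0 : ℝ) < (1 / 32) ^ k := by positivity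
  rw [pow_succ]
  nlinarith

theorem arcWeight_le (k : ℕ) : arcWeight k ≤ (1 / 8) ^ k := by
  induction k with
  | zero => simp [arcWeight_zero]
  | succ k ih =>
    rw [pow_succ]
    linarith [arcWeight_succ_le k]

theorem sum_arcWeight_mul_le (k : ℕ) :
    ∑ i ∈ Finset.range k, arcWeight i * arcWeight (k - 1 - i) ≤ 1024 * arcWeight (k + 1) := by
  rcases k with _ | m
  · simpa using (arcWeight_pos 1).le
  have h1 : ∑ i ∈ Finset.range (m + 1), arcWeight i * arcWeight (m + 1 - 1 - i) =
      catalan (m + 1) * (1 / 32) ^ m := by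
    rw [catalan_succ, ← Fin.sum_univ_eq_sum_range
      (fun i => arcWeight i * arcWeight (m + 1 - 1 - i)), Nat.cast_sum, Finset.sum_mul]
    refine Finset.sum_congr rfl fun i _ => ?_
    have hi : (i : ℕ) + (m - i) = m := by have := i.2; omega
    have hpow : ((1 : ℝ) / 32) ^ m = (1 / 32) ^ (i : ℕ) * (1 / 32) ^ (m - i) := by
      rw [← pow_add, hi]
    unfold arcWeight
    rw [hpow, Nat.add_sub_cancel]
    push_cast
    ring
  rw [h1]
  have h : (catalan (m + 1) : ℝ) ≤ catalan (m + 1 + 1) := by exact_mod_cast catalan_le_succ _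
  have : (0 : ℝ) < (1 / 32) ^ m := by positivity
  unfold arcWeight
  rw [pow_succ, pow_succ]
  nlinarith

/-- The relative increase of the bound caused by an update of the edge in position `i` of an
arc of length `k`. -/
noncomputable def arcGain (p : ℝ) (k i : ℕ) : ℝ :=
  if k = 0 ∨ k < i then 0
  else if i = 0 ∨ i = k then (arcWeight (k + 1) + p * arcWeight (k - 1)) / arcWeight k - 1
  else p ^ 2 * (arcWeight (i - 1) * arcWeight (k - 1 - i)) / arcWeight k

theorem sum_arcGain_nonpos {p : ℝ} (hp : 0 ≤ p) (hp' : p ≤ 1 / 128) {k N : ℕ} (hk : k < N) :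
    ∑ i ∈ Finset.range N, arcGain p k i ≤ 0 := by
  rcases k with _ | k
  · simp [arcGain]
  have hsub : ∑ i ∈ Finset.range N, arcGain p (k + 1) i =
      ∑ i ∈ Finset.range (k + 2), arcGain p (k + 1) i := by
    symm
    refine Finset.sum_subset (Finset.range_subset_range.mpr hk) fun i _ hi => ?_
    simp only [Finset.mem_range] at hi
    rw [arcGain, if_pos (Or.inr (by omega))]
  have hmid : ∀ i ∈ Finset.range k, arcGain p (k + 1) (i + 1) =
      p ^ 2 / arcWeight (k + 1) * (arcWeight i * arcWeight (k - 1 - i)) := by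
    intro i hi
    simp only [Finset.mem_range] at hi
    rw [arcGain, if_neg (by omega), if_neg (by omega)]
    rw [show k + 1 - 1 - (i + 1) = k - 1 - i by omega, Nat.add_sub_cancel]
    ring
  rw [hsub, Finset.sum_range_succ, Finset.sum_range_succ', Finset.sum_congr rfl hmid,
    ← Finset.mul_sum]
  have h0 : arcGain p (k + 1) 0 = (arcWeight (k + 2) + p * arcWeight k) / arcWeight (k + 1) - 1 := by
    simp [arcGain]
  have h1 : arcGain p (k + 1) (k + 1) =
      (arcWeight (k + 2) + p * arcWeight k) / arcWeight (k + 1) - 1 := by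
    simp [arcGain]
  rw [h0, h1]
  have hw := arcWeight_pos (k + 1)
  have h2 : p ^ 2 / arcWeight (k + 1) *
      ∑ i ∈ Finset.range k, arcWeight i * arcWeight (k - 1 - i) ≤ 1 / 16 := by
    rw [div_mul_eq_mul_div, div_le_iff₀ hw]
    have hp2 : p ^ 2 ≤ (1 / 128) ^ 2 := pow_le_pow_left₀ hp hp' 2
    calc _ ≤ (1 / 128) ^ 2 * (1024 * arcWeight (k + 1)) := by
          exact mul_le_mul hp2 (sum_arcWeight_mul_le k)
            (Finset.sum_nonneg fun i _ => (mul_pos (arcWeight_pos _) (arcWeight_pos _)).le)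
            (by norm_num)
      _ = _ := by ring
  have h3 : (arcWeight (k + 2) + p * arcWeight k) / arcWeight (k + 1) ≤ 3 / 8 := by
    rw [div_le_iff₀ hw]
    have h4 := arcWeight_succ_le (k + 1)
    have h5 := arcWeight_le_succ k
    have h6 : p * arcWeight k ≤ 1 / 128 * (32 * arcWeight (k + 1)) := by
      have := (arcWeight_pos k).le
      gcongr
    linarith
  linarith

/-! ### Evolution of the probability that arcs lie in distinct runs -/

/-- Indicator function of `InDistinctRuns`. -/
noncomputable def runIndicator (J : Finset ℕ) (a : ℕ → ZMod n) (l : ℕ → ℕ) (S : Config n) : ℝ :=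
  if InDistinctRuns J a l S then 1 else 0

theorem runIndicator_nonneg (J : Finset ℕ) (a : ℕ → ZMod n) (l : ℕ → ℕ) (S : Config n) :
    0 ≤ runIndicator J a l S := by
  unfold runIndicator; split_ifs <;> norm_num

theorem runIndicator_le_of_imp {J J' : Finset ℕ} {a a' : ℕ → ZMod n} {l l' : ℕ → ℕ}
    {S S' : Config n} (h : InDistinctRuns J a l S → InDistinctRuns J' a' l' S') :
    runIndicator J a l S ≤ runIndicator J' a' l' S' := by
  unfold runIndicator
  split_ifs with h1 h2
  · exact le_rfl
  · exact absurd (h h1) h2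
  · norm_num
  · exact le_rfl

theorem update_agree (S : Config n) (e : ZMod n) (b c : Bool) (x : ZMod n) (hx : x ≠ e)
    (hx' : x ≠ e + 1) : Function.update (Function.update S e b) (e + 1) c x = S x := by
  simp [Function.update_of_ne hx, Function.update_of_ne hx']

theorem edgeOp_runIndicator_of_not_meets [NeZero n] {p : ℝ} (hp : 0 ≤ p) (hp' : p ≤ 1)
    {J : Finset ℕ} {a : ℕ → ZMod n} {l : ℕ → ℕ} (hln : ∀ j ∈ J, l j < n) {e : ZMod n}
    (hne : e ≠ e + 1) (hJ : ∀ j ∈ J, ¬Meets (a j) (l j) e) (S : Config n) :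
    edgeOp p e (runIndicator J a l) S ≤ runIndicator J a l S := by
  by_cases h₁ : S e = true ∧ S (e + 1) = true
  · rw [edgeOp_of_cooperate p _ h₁]
  by_cases h₂ : S e = false ∧ S (e + 1) = false
  · have key : ∀ b : Bool × Bool, runIndicator J a l
        (Function.update (Function.update S e b.1) (e + 1) b.2) ≤ runIndicator J a l S :=
      fun b => runIndicator_le_of_imp fun h =>
        h.of_defect (update_agree S e b.1 b.2) h₂.1 h₂.2 fun j hj i hi hmem =>
          hJ j hj (meets_of_mem (hln j hj) hi hmem)
    rw [edgeOp_of_defect p hne _ h₂]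
    have hq : 0 ≤ 1 - p := by linarith
    calc _ ≤ ∑ b : Bool × Bool, (if b.1 = true then p else 1 - p) *
          (if b.2 = true then p else 1 - p) * runIndicator J a l S := by
          refine Finset.sum_le_sum fun b _ => mul_le_mul_of_nonneg_left (key b) ?_
          apply mul_nonneg <;> split_ifs <;> assumption
      _ = _ := by
          rw [Fintype.sum_prod_type]
          simp
          ring
  · rw [edgeOp_of_mixed p _ h₁ h₂]
    exact runIndicator_le_of_imp fun h => h.of_mixed hne h₁

theorem runIndicator_eq_zero_of_defect [NeZero n] {J : Finset ℕ} {a : ℕ → ZMod n} {l : ℕ → ℕ}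
    {S : Config n} {j i : ℕ} (hj : j ∈ J) (hi : i < l j) (h : S (a j + (i : ZMod n)) = false) :
    runIndicator J a l S = 0 := by
  refine if_neg fun hS => ?_
  obtain ⟨-, φ, -, hA⟩ := hS
  have := (hA j hj i hi).1
  rw [h] at this
  exact absurd this (by simp)

section Meeting

variable [NeZero n] {p : ℝ} {J : Finset ℕ} {a : ℕ → ZMod n} {l : ℕ → ℕ} {e : ZMod n}
  {j i m : ℕ} {S : Config n}

theorem edgeOp_runIndicator_of_mixed_meets (hne : e ≠ e + 1) (hj : j ∈ J)
    (hmeet : Meets (a j) (l j) e)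
    (h₁ : ¬(S e = true ∧ S (e + 1) = true)) (h₂ : ¬(S e = false ∧ S (e + 1) = false)) :
    edgeOp p e (runIndicator J a l) S = 0 := by
  rw [edgeOp_of_mixed p _ h₁ h₂]
  obtain ⟨s, hs, h⟩ := hmeet.exists_mem
  refine runIndicator_eq_zero_of_defect hj hs ?_
  rcases h with h | h <;> rw [h] <;> simp [Function.update_of_ne hne]

/-- The indicator of the family in which the edge in position `i` of the arc `j` is removed. -/
noncomputable def splitIndicator (J : Finset ℕ) (a : ℕ → ZMod n) (l : ℕ → ℕ) (j i m : ℕ) :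
    Config n → ℝ :=
  runIndicator (insert m J) (Function.update a m (a j + i + 1))
    (Function.update (Function.update l j (i - 1)) m (l j - 1 - i))

theorem edgeOp_runIndicator_of_interior (hne : e ≠ e + 1) (hj : j ∈ J)
    (hmeet : Meets (a j) (l j) e) (hei : e + 1 = a j + (i : ZMod n)) (hi0 : 0 < i)
    (hi : i < l j) (hm : m ∉ J) :
    edgeOp p e (runIndicator J a l) S ≤
      runIndicator J a l S + p ^ 2 * splitIndicator J a l j i m S := by
  have hn1 := runIndicator_nonneg J a l S
  have hn2 : 0 ≤ splitIndicator J a l j i m S := runIndicator_nonneg _ _ _ _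
  by_cases h₁ : S e = true ∧ S (e + 1) = true
  · rw [edgeOp_of_cooperate p _ h₁]
    nlinarith [sq_nonneg p]
  by_cases h₂ : S e = false ∧ S (e + 1) = false
  · have key : ∀ b c : Bool, runIndicator J a l
        (Function.update (Function.update S e b) (e + 1) c) ≤ splitIndicator J a l j i m S :=
      fun b c => runIndicator_le_of_imp fun h =>
        h.split (update_agree S e b c) h₂.1 h₂.2 hj (by omega) hi.le hei hm
    have hl : ∀ c : Bool, runIndicator J a l
        (Function.update (Function.update S e false) (e + 1) c) = 0 := fun c => by
      refine runIndicator_eq_zero_of_defect hj (i := i - 1) (by omega) ?_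
      have : a j + ((i - 1 : ℕ) : ZMod n) = e := by
        rw [Nat.cast_sub hi0]; push_cast; linear_combination -hei
      rw [this]; simp [Function.update_of_ne hne]
    have hr : ∀ b : Bool, runIndicator J a l
        (Function.update (Function.update S e b) (e + 1) false) = 0 := fun b => by
      refine runIndicator_eq_zero_of_defect hj hi ?_
      rw [← hei]; simp
    rw [edgeOp_of_defect p hne _ h₂, Fintype.sum_prod_type]
    simp only [Fintype.sum_bool, hl, hr]
    have := mul_le_mul_of_nonneg_left (key true true) (sq_nonneg p)
    simp
    linarith
  · rw [edgeOp_runIndicator_of_mixed_meets hne hj hmeet h₁ h₂]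
    positivity

theorem edgeOp_runIndicator_of_left (hp : 0 ≤ p) (hp' : p ≤ 1) (hne : e ≠ e + 1) (hj : j ∈ J)
    (hmeet : Meets (a j) (l j) e) (hei : e + 1 = a j) (hm : m ∉ J) :
    edgeOp p e (runIndicator J a l) S ≤
      runIndicator J (Function.update a j e) (Function.update l j (l j + 1)) S +
        p * splitIndicator J a l j 0 m S := by
  have hn1 := runIndicator_nonneg J (Function.update a j e) (Function.update l j (l j + 1)) S
  have hn2 : 0 ≤ splitIndicator J a l j 0 m S := runIndicator_nonneg _ _ _ _
  have hn3 := mul_nonneg hp hn2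
  by_cases h₁ : S e = true ∧ S (e + 1) = true
  · rw [edgeOp_of_cooperate p _ h₁]
    have := runIndicator_le_of_imp fun h : InDistinctRuns J a l S =>
      h.extend_left h₁ hj hmeet.1 hei
    linarith
  by_cases h₂ : S e = false ∧ S (e + 1) = false
  · have key : ∀ b c : Bool, runIndicator J a l
        (Function.update (Function.update S e b) (e + 1) c) ≤ splitIndicator J a l j 0 m S :=
      fun b c => runIndicator_le_of_imp fun h =>
        h.split (update_agree S e b c) h₂.1 h₂.2 hj hmeet.1 (Nat.zero_le _) (by simpa using hei) hm
    have hr : ∀ b : Bool, runIndicator J a l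
        (Function.update (Function.update S e b) (e + 1) false) = 0 := fun b => by
      refine runIndicator_eq_zero_of_defect hj hmeet.1 ?_
      rw [Nat.cast_zero, add_zero, ← hei]; simp
    rw [edgeOp_of_defect p hne _ h₂, Fintype.sum_prod_type]
    simp only [Fintype.sum_bool, hr]
    have h3 := mul_le_mul_of_nonneg_left (key true true) (mul_nonneg hp hp)
    have h4 := mul_le_mul_of_nonneg_left (key false true)
      (mul_nonneg (sub_nonneg.mpr hp') hp)
    simp
    linarith
  · rw [edgeOp_runIndicator_of_mixed_meets hne hj hmeet h₁ h₂]
    positivity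

theorem edgeOp_runIndicator_of_right (hp : 0 ≤ p) (hp' : p ≤ 1) (hne : e ≠ e + 1) (hj : j ∈ J)
    (hmeet : Meets (a j) (l j) e) (hei : e + 1 = a j + (l j : ZMod n)) (hm : m ∉ J) :
    edgeOp p e (runIndicator J a l) S ≤
      runIndicator J a (Function.update l j (l j + 1)) S +
        p * splitIndicator J a l j (l j) m S := by
  have hn1 := runIndicator_nonneg J a (Function.update l j (l j + 1)) S
  have hn2 : 0 ≤ splitIndicator J a l j (l j) m S := runIndicator_nonneg _ _ _ _
  have hn3 := mul_nonneg hp hn2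
  by_cases h₁ : S e = true ∧ S (e + 1) = true
  · rw [edgeOp_of_cooperate p _ h₁]
    have := runIndicator_le_of_imp fun h : InDistinctRuns J a l S =>
      h.extend_right h₁ hj hmeet.1 hei
    linarith
  by_cases h₂ : S e = false ∧ S (e + 1) = false
  · have key : ∀ b c : Bool, runIndicator J a l
        (Function.update (Function.update S e b) (e + 1) c) ≤
          splitIndicator J a l j (l j) m S :=
      fun b c => runIndicator_le_of_imp fun h =>
        h.split (update_agree S e b c) h₂.1 h₂.2 hj hmeet.1 le_rfl hei hm
    have hl : ∀ c : Bool, runIndicator J a l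
        (Function.update (Function.update S e false) (e + 1) c) = 0 := fun c => by
      have hl0 := hmeet.1
      refine runIndicator_eq_zero_of_defect hj (i := l j - 1) (by omega) ?_
      have : a j + ((l j - 1 : ℕ) : ZMod n) = e := by
        rw [Nat.cast_sub hl0]; push_cast; linear_combination -hei
      rw [this]; simp [Function.update_of_ne hne]
    rw [edgeOp_of_defect p hne _ h₂, Fintype.sum_prod_type]
    simp only [Fintype.sum_bool, hl]
    have h3 := mul_le_mul_of_nonneg_left (key true true) (mul_nonneg hp hp)
    have h4 := mul_le_mul_of_nonneg_left (key true false)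
      (mul_nonneg hp (sub_nonneg.mpr hp'))
    simp
    linarith
  · rw [edgeOp_runIndicator_of_mixed_meets hne hj hmeet h₁ h₂]
    positivity

end Meeting

/-- The bound on the probability that a family of arcs lies in distinct runs. -/
noncomputable def familyWeight (J : Finset ℕ) (l : ℕ → ℕ) : ℝ := ∏ j ∈ J, arcWeight (l j)

theorem familyWeight_pos (J : Finset ℕ) (l : ℕ → ℕ) : 0 < familyWeight J l :=
  Finset.prod_pos fun _ _ => arcWeight_pos _

theorem familyWeight_eq {J : Finset ℕ} {j : ℕ} (hj : j ∈ J) (l : ℕ → ℕ) :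
    familyWeight J l = arcWeight (l j) * familyWeight (J.erase j) l :=
  (Finset.mul_prod_erase J (fun j => arcWeight (l j)) hj).symm

theorem familyWeight_congr {J : Finset ℕ} {l l' : ℕ → ℕ} (h : ∀ j ∈ J, l j = l' j) :
    familyWeight J l = familyWeight J l' :=
  Finset.prod_congr rfl fun j hj => by rw [h j hj]

theorem familyWeight_update {J : Finset ℕ} {j : ℕ} (hj : j ∈ J) (l : ℕ → ℕ) (x : ℕ) :
    familyWeight J (Function.update l j x) = arcWeight x * familyWeight (J.erase j) l := by
  rw [familyWeight_eq hj, Function.update_self]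
  congr 1
  exact familyWeight_congr fun k hk => Function.update_of_ne (Finset.ne_of_mem_erase hk) _ _

theorem familyWeight_insert_update {J : Finset ℕ} {m : ℕ} (hm : m ∉ J) (l : ℕ → ℕ) (x : ℕ) :
    familyWeight (insert m J) (Function.update l m x) = arcWeight x * familyWeight J l := by
  rw [familyWeight, Finset.prod_insert hm, Function.update_self]
  congr 1
  exact familyWeight_congr fun k hk =>
    Function.update_of_ne (ne_of_mem_of_not_mem hk hm) _ _

theorem self_ne_add_one (hn : 3 ≤ n) (e : ZMod n) : e ≠ e + 1 := by
  have : Fact (1 < n) := ⟨by omega⟩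
  simp

section Step

variable [NeZero n] {p : ℝ} {μ : Config n → ℝ}

theorem sum_mul_le_of_le {f g h : Config n → ℝ} {q A B : ℝ} (hq : 0 ≤ q) (hμ0 : ∀ S, 0 ≤ μ S)
    (hf : ∀ S, f S ≤ g S + q * h S) (hg : ∑ S, μ S * g S ≤ A) (hh : ∑ S, μ S * h S ≤ B) :
    ∑ S, μ S * f S ≤ A + q * B := by
  calc ∑ S, μ S * f S ≤ ∑ S, (μ S * g S + q * (μ S * h S)) := by
        refine Finset.sum_le_sum fun S _ => ?_
        nlinarith [mul_le_mul_of_nonneg_left (hf S) (hμ0 S)]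
    _ = ∑ S, μ S * g S + q * ∑ S, μ S * h S := by
        rw [Finset.sum_add_distrib, Finset.mul_sum]
    _ ≤ _ := add_le_add hg (mul_le_mul_of_nonneg_left hh hq)

theorem sum_mul_edgeOp_le (hn : 3 ≤ n) (hp : 0 ≤ p) (hp' : p ≤ 1) (hμ0 : ∀ S, 0 ≤ μ S)
    (hμ : ∀ J a l, ∑ S, μ S * runIndicator J a l S ≤ familyWeight J l)
    {J : Finset ℕ} {a : ℕ → ZMod n} {l : ℕ → ℕ} {T : Config n} (hT : InDistinctRuns J a l T)
    (e : ZMod n) :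
    ∑ S, μ S * edgeOp p e (runIndicator J a l) S ≤
      familyWeight J l * (1 + ∑ j ∈ J, arcGain p (l j) (e + 1 - a j).val) := by
  have hne := self_ne_add_one hn e
  have hgain : ∀ j, ¬Meets (a j) (l j) e → arcGain p (l j) (e + 1 - a j).val = 0 := by
    intro j hj
    refine if_pos ?_
    by_contra hcon
    exact hj ⟨by omega, by omega⟩
  by_cases hJ : ∃ j ∈ J, Meets (a j) (l j) e
  · obtain ⟨j, hj, hmeet⟩ := hJ
    rw [Finset.sum_eq_single_of_mem j hj fun k hk hkj => hgain k fun h =>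
      hkj (hT.eq_of_meets hk hj h hmeet)]
    obtain ⟨m, hm⟩ := Infinite.exists_notMem_finset J
    have hei := eq_add_val (a j) (e + 1)
    have hl := hmeet.1
    have hil := hmeet.2
    generalize (e + 1 - a j).val = i at hei hil
    have hw := (arcWeight_pos (l j)).ne'
    have hsplit : ∑ S, μ S * splitIndicator J a l j i m S ≤
        arcWeight (l j - 1 - i) * (arcWeight (i - 1) * familyWeight (J.erase j) l) := by
      rw [← familyWeight_update hj, ← familyWeight_insert_update hm]
      exact hμ _ _ _
    rw [familyWeight_eq hj, arcGain, if_neg (by omega)]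
    by_cases hb : i = 0 ∨ i = l j
    · rw [if_pos hb]
      have hext : ∀ a', ∑ S, μ S * runIndicator J a' (Function.update l j (l j + 1)) S ≤
          arcWeight (l j + 1) * familyWeight (J.erase j) l := fun a' => by
        rw [← familyWeight_update hj]
        exact hμ _ _ _
      have hgoal : ∑ S, μ S * edgeOp p e (runIndicator J a l) S ≤
          arcWeight (l j + 1) * familyWeight (J.erase j) l + p *
            (arcWeight (l j - 1 - i) * (arcWeight (i - 1) * familyWeight (J.erase j) l)) := by
        rcases hb with rfl | rfl
        · exact sum_mul_le_of_le hp hμ0 (fun S => edgeOp_runIndicator_of_left hp hp' hne hj hmeet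
            (by simpa using hei) hm) (hext _) hsplit
        · exact sum_mul_le_of_le hp hμ0 (fun S => edgeOp_runIndicator_of_right hp hp' hne hj hmeet
            hei hm) (hext _) hsplit
      have hprod : arcWeight (l j - 1 - i) * arcWeight (i - 1) = arcWeight (l j - 1) := by
        rcases hb with rfl | rfl
        · simp [arcWeight_zero]
        · rw [show l j - 1 - l j = 0 by omega, arcWeight_zero, one_mul]
      rw [← mul_assoc (arcWeight _) (arcWeight _), hprod] at hgoal
      refine hgoal.trans_eq ?_
      field_simp
      ring
    · rw [if_neg hb]
      push Not at hb
      refine (sum_mul_le_of_le (sq_nonneg p) hμ0 (fun S => edgeOp_runIndicator_of_interior hne hj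
        hmeet hei (by omega) (by omega) hm) (hμ J a l) hsplit).trans_eq ?_
      rw [familyWeight_eq hj]
      field_simp
  · push Not at hJ
    rw [Finset.sum_eq_zero fun j hj => hgain j (hJ j hj), add_zero, mul_one]
    refine le_trans (Finset.sum_le_sum fun S _ => mul_le_mul_of_nonneg_left
      (edgeOp_runIndicator_of_not_meets hp hp' (fun j hj => hT.length_lt hj) hne hJ S) (hμ0 S)) ?_
    exact hμ J a l

theorem sum_rpStepProb_mul (p : ℝ) (f : Config n → ℝ) (S : Config n) :
    ∑ T, rpStepProb p S T * f T = (1 / (n : ℝ)) * ∑ e : ZMod n, edgeOp p e f S := by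
  simp only [rpStepProb, edgeOp, mul_assoc, ← Finset.mul_sum, Finset.sum_mul]
  rw [Finset.sum_comm]

theorem sum_mul_sum_rpStepProb (p : ℝ) (μ f : Config n → ℝ) :
    ∑ S, μ S * ∑ T, rpStepProb p S T * f T =
      (1 / (n : ℝ)) * ∑ e : ZMod n, ∑ S, μ S * edgeOp p e f S := by
  simp only [sum_rpStepProb_mul]
  rw [Finset.sum_comm, Finset.mul_sum]
  refine Finset.sum_congr rfl fun S _ => ?_
  rw [← Finset.mul_sum]
  ring

/-- One step of the chain preserves the bounds by `familyWeight`. -/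
theorem sum_mul_step_le (hn : 3 ≤ n) (hp : 0 ≤ p) (hp' : p ≤ 1 / 128) (hμ0 : ∀ S, 0 ≤ μ S)
    (hμ : ∀ J a l, ∑ S, μ S * runIndicator J a l S ≤ familyWeight J l)
    (J : Finset ℕ) (a : ℕ → ZMod n) (l : ℕ → ℕ) :
    ∑ S, μ S * ∑ T, rpStepProb p S T * runIndicator J a l T ≤ familyWeight J l := by
  by_cases hT : ∃ T : Config n, InDistinctRuns J a l T
  · obtain ⟨T, hT⟩ := hT
    rw [sum_mul_sum_rpStepProb]
    have hn0 : (0 : ℝ) < n := by exact_mod_cast (by omega : 0 < n)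
    have hgain : ∀ j ∈ J, ∑ e : ZMod n, arcGain p (l j) (e + 1 - a j).val ≤ 0 := by
      intro j hj
      refine le_trans (le_of_eq ?_) (sum_arcGain_nonpos hp hp' (hT.length_lt hj))
      refine Finset.sum_bij (fun e _ => (e + 1 - a j).val) ?_ ?_ ?_ ?_
      · intro e _
        simpa using ZMod.val_lt _
      · intro e _ e' _ h
        simpa using ZMod.val_injective n h
      · intro i hi
        refine ⟨a j + i - 1, Finset.mem_univ _, ?_⟩
        simp [ZMod.val_natCast_of_lt (Finset.mem_range.mp hi)]
      · intro e _
        rfl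
    have hsum : ∑ e : ZMod n, ∑ S, μ S * edgeOp p e (runIndicator J a l) S ≤
        familyWeight J l * n := by
      calc _ ≤ ∑ e : ZMod n,
            familyWeight J l * (1 + ∑ j ∈ J, arcGain p (l j) (e + 1 - a j).val) :=
            Finset.sum_le_sum fun e _ =>
              sum_mul_edgeOp_le hn hp (hp'.trans (by norm_num)) hμ0 hμ hT e
        _ = familyWeight J l *
            (n + ∑ j ∈ J, ∑ e : ZMod n, arcGain p (l j) (e + 1 - a j).val) := by
            rw [← Finset.mul_sum, Finset.sum_add_distrib, Finset.sum_comm]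
            simp [ZMod.card]
        _ ≤ familyWeight J l * (n + 0) :=
            mul_le_mul_of_nonneg_left (add_le_add_right (Finset.sum_nonpos hgain) _)
              (familyWeight_pos J l).le
        _ = _ := by rw [add_zero]
    rw [one_div, inv_mul_le_iff₀ hn0]
    linarith
  · push Not at hT
    simp only [runIndicator, if_neg (hT _), mul_zero, Finset.sum_const_zero]
    exact (familyWeight_pos J l).le

end Step

/-! ### The law of the chain -/

theorem rpStepProb_nonneg [NeZero n] {p : ℝ} (hp : 0 ≤ p) (hp' : p ≤ 1) (S T : Config n) :
    0 ≤ rpStepProb p S T := by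
  have hq : 0 ≤ 1 - p := by linarith
  refine mul_nonneg (by positivity) (Finset.sum_nonneg fun i _ => ?_)
  unfold rpUpdProb
  split_ifs <;> positivity

/-- The transition matrix of the chain. -/
noncomputable def rpMatrix (p : ℝ) (n : ℕ) [NeZero n] : Matrix (Config n) (Config n) ℝ :=
  Matrix.of (rpStepProb p)

theorem rpMatrix_pow_nonneg [NeZero n] {p : ℝ} (hp : 0 ≤ p) (hp' : p ≤ 1) (t : ℕ)
    (S T : Config n) : 0 ≤ (rpMatrix p n ^ t) S T := by
  induction t generalizing T with
  | zero => rw [pow_zero, Matrix.one_apply]; split_ifs <;> norm_num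
  | succ t ih =>
    rw [pow_succ, Matrix.mul_apply]
    exact Finset.sum_nonneg fun U _ => mul_nonneg (ih U) (rpStepProb_nonneg hp hp' U T)

theorem sum_rpMatrix_pow_succ [NeZero n] (p : ℝ) (t : ℕ) (S₀ : Config n) (f : Config n → ℝ) :
    ∑ T, (rpMatrix p n ^ (t + 1)) S₀ T * f T =
      ∑ S, (rpMatrix p n ^ t) S₀ S * ∑ T, rpStepProb p S T * f T := by
  simp only [pow_succ, Matrix.mul_apply, Finset.sum_mul, Finset.mul_sum]
  rw [Finset.sum_comm]
  simp only [rpMatrix, Matrix.of_apply, mul_assoc]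

/-- Started from all-defect, the probability that given arcs lie in distinct cooperating runs is
at most the product of the weights of the arcs, at all times. -/
theorem sum_law_runIndicator_le [NeZero n] (hn : 3 ≤ n) {p : ℝ} (hp : 0 ≤ p) (hp' : p ≤ 1 / 128)
    (t : ℕ) (J : Finset ℕ) (a : ℕ → ZMod n) (l : ℕ → ℕ) :
    ∑ S, (rpMatrix p n ^ t) (fun _ => false) S * runIndicator J a l S ≤ familyWeight J l := by
  induction t generalizing J a l with
  | zero =>
    simp only [pow_zero, Matrix.one_apply, ite_mul, one_mul, zero_mul, Finset.sum_ite_eq,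
      Finset.mem_univ, if_true]
    by_cases h : ∃ j ∈ J, 0 < l j
    · obtain ⟨j, hj, hl⟩ := h
      rw [runIndicator_eq_zero_of_defect hj hl rfl]
      exact (familyWeight_pos J l).le
    · push Not at h
      have : familyWeight J l = 1 := Finset.prod_eq_one fun j hj => by
        rw [Nat.le_zero.mp (h j hj), arcWeight_zero]
      rw [this, runIndicator]
      split_ifs <;> norm_num
  | succ t ih =>
    rw [sum_rpMatrix_pow_succ]
    exact sum_mul_step_le hn hp hp'
      (fun S => rpMatrix_pow_nonneg hp (hp'.trans (by norm_num)) t _ S) ih J a l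

/-- Indicator function of the all-cooperate configuration. -/
noncomputable def allCooperate (S : Config n) : ℝ := if S = fun _ => true then 1 else 0

theorem allCooperate_nonneg (S : Config n) : 0 ≤ allCooperate S := by
  unfold allCooperate; split_ifs <;> norm_num

theorem allCooperate_eq_zero {S : Config n} {x : ZMod n} (h : S x = false) :
    allCooperate S = 0 :=
  if_neg fun hS => by simp [hS] at h

theorem edgeOp_allCooperate_le [NeZero n] (hn : 3 ≤ n) {p : ℝ} (e : ZMod n) (S : Config n) :
    edgeOp p e allCooperate S ≤ allCooperate S +
      p ^ 2 * runIndicator {0} (fun _ => e + 2) (fun _ => n - 2) S := by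
  have hne := self_ne_add_one hn e
  have hn1 := allCooperate_nonneg S
  have hn2 := runIndicator_nonneg {0} (fun _ => e + 2) (fun _ => n - 2) S
  by_cases h₁ : S e = true ∧ S (e + 1) = true
  · rw [edgeOp_of_cooperate p _ h₁]
    nlinarith [sq_nonneg p]
  by_cases h₂ : S e = false ∧ S (e + 1) = false
  · rw [edgeOp_of_defect p hne _ h₂, Fintype.sum_prod_type]
    have hl : ∀ c, allCooperate (Function.update (Function.update S e false) (e + 1) c) = 0 :=
      fun c => allCooperate_eq_zero (x := e) (by simp [Function.update_of_ne hne])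
    have hr : ∀ b, allCooperate (Function.update (Function.update S e b) (e + 1) false) = 0 :=
      fun b => allCooperate_eq_zero (x := e + 1) (by simp)
    have key : allCooperate (Function.update (Function.update S e true) (e + 1) true) ≤
        runIndicator {0} (fun _ => e + 2) (fun _ => n - 2) S := by
      unfold allCooperate runIndicator
      split_ifs with hfull hruns
      · exact le_rfl
      · refine absurd ⟨fun h => by simp [h] at h₁, fun _ => 0, fun _ _ _ => rfl, ?_⟩ hruns
        intro j hj i hi
        have hi' : i < n - 2 := hi
        refine ⟨?_, (Finset.mem_singleton.mp hj).symm⟩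
        rw [← update_agree S e true true, hfull]
        · intro h
          have h3 : e + ((i + 2 : ℕ) : ZMod n) = e + ((0 : ℕ) : ZMod n) := by
            push_cast; linear_combination h
          have := natCast_add_inj (by omega) (by omega) h3
          omega
        · intro h
          have h3 : e + ((i + 2 : ℕ) : ZMod n) = e + ((1 : ℕ) : ZMod n) := by
            push_cast; linear_combination h
          have := natCast_add_inj (by omega) (by omega) h3
          omega
      · norm_num
      · exact le_rfl
    have h3 := mul_le_mul_of_nonneg_left key (sq_nonneg p)
    simp only [Fintype.sum_bool, hl, hr]
    simp
    linarith
  · rw [edgeOp_of_mixed p _ h₁ h₂, allCooperate_eq_zero (x := e + 1) (by simp)]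
    positivity

theorem sum_law_allCooperate_le [NeZero n] (hn : 3 ≤ n) {p : ℝ} (hp : 0 ≤ p) (hp' : p ≤ 1 / 128)
    (t : ℕ) :
    ∑ S, (rpMatrix p n ^ t) (fun _ => false) S * allCooperate S ≤
      t * (p ^ 2 * arcWeight (n - 2)) := by
  induction t with
  | zero =>
    simp only [pow_zero, Matrix.one_apply, ite_mul, one_mul, zero_mul, Finset.sum_ite_eq,
      Finset.mem_univ, if_true]
    rw [allCooperate_eq_zero (x := 0) rfl]
    simp
  | succ t ih =>
    rw [sum_rpMatrix_pow_succ, sum_mul_sum_rpStepProb]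
    have hn0 : (0 : ℝ) < n := by exact_mod_cast (by omega : 0 < n)
    have hedge : ∀ e : ZMod n,
        ∑ S, (rpMatrix p n ^ t) (fun _ => false) S * edgeOp p e allCooperate S ≤
          t * (p ^ 2 * arcWeight (n - 2)) + p ^ 2 * arcWeight (n - 2) := fun e => by
      refine sum_mul_le_of_le (sq_nonneg p)
        (fun S => rpMatrix_pow_nonneg hp (hp'.trans (by norm_num)) t _ S)
        (fun S => edgeOp_allCooperate_le hn e S) ih ?_
      refine (sum_law_runIndicator_le hn hp hp' t _ _ _).trans_eq ?_
      simp [familyWeight]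
    rw [one_div, inv_mul_le_iff₀ hn0]
    refine (Finset.sum_le_sum fun e _ => hedge e).trans_eq ?_
    simp [ZMod.card]
    ring

/-! ### Trajectories -/

theorem rpTrajProb_mono [NeZero n] {p : ℝ} (hp : 0 ≤ p) (hp' : p ≤ 1) (S₀ : Config n) (t : ℕ)
    {E E' : (Fin (t + 1) → Config n) → Prop} (h : ∀ σ, E σ → E' σ) :
    rpTrajProb p S₀ t E ≤ rpTrajProb p S₀ t E' := by
  refine Finset.sum_le_sum fun σ _ => ?_
  have := Finset.prod_nonneg fun (s : Fin t) (_ : s ∈ Finset.univ) =>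
    rpStepProb_nonneg hp hp' (σ s.castSucc) (σ s.succ)
  by_cases h1 : σ 0 = S₀ ∧ E σ
  · rw [if_pos h1, if_pos ⟨h1.1, h σ h1.2⟩]
  · rw [if_neg h1]
    split_ifs <;> first | assumption | exact le_rfl

theorem rpTrajProb_congr [NeZero n] (p : ℝ) (S₀ : Config n) (t : ℕ)
    {E E' : (Fin (t + 1) → Config n) → Prop} (h : ∀ σ, σ 0 = S₀ → (E σ ↔ E' σ)) :
    rpTrajProb p S₀ t E = rpTrajProb p S₀ t E' := by
  refine Finset.sum_congr rfl fun σ _ => ?_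
  simp only [and_congr_right (h σ)]

/-- Markov property at the first step. -/
theorem rpTrajProb_succ [NeZero n] (p : ℝ) (S₀ : Config n) (t : ℕ)
    (E : (Fin (t + 1 + 1) → Config n) → Prop) :
    rpTrajProb p S₀ (t + 1) E = ∑ T, rpStepProb p S₀ T *
      rpTrajProb p T t (fun σ => E (Fin.cons (α := fun _ => Config n) S₀ σ)) := by
  unfold rpTrajProb
  rw [← (Fin.consEquiv (fun _ : Fin (t + 1 + 1) => Config n)).sum_comp, Fintype.sum_prod_type]
  simp only [Finset.mul_sum]
  rw [Finset.sum_comm, Finset.sum_comm (s := (Finset.univ : Finset (Config n)))]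
  refine Finset.sum_congr rfl fun σ _ => ?_
  rw [Finset.sum_eq_single_of_mem S₀ (Finset.mem_univ _),
    Finset.sum_eq_single_of_mem (σ 0) (Finset.mem_univ _)]
  · simp [Fin.consEquiv, Fin.prod_univ_succ]
  · intro T _ hT
    rw [if_neg fun h => hT h.1.symm, mul_zero]
  · intro T _ hT
    rw [if_neg fun h => hT (by simpa [Fin.consEquiv] using h.1)]

theorem rpStepProb_allCooperate [NeZero n] (p : ℝ) (T : Config n) :
    rpStepProb p (fun _ => true) T = if T = fun _ => true then 1 else 0 := by
  have : (n : ℝ) ≠ 0 := by exact_mod_cast NeZero.ne n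
  simp [rpStepProb, rpUpdProb, ZMod.card, this]

/-- Since all-cooperate is absorbing, it has been visited iff it is the current state. -/
theorem rpTrajProb_exists_eq [NeZero n] (p : ℝ) (t : ℕ) (S₀ : Config n) :
    rpTrajProb p S₀ t (fun σ => ∃ s, σ s = fun _ => true) =
      ∑ S, (rpMatrix p n ^ t) S₀ S * allCooperate S := by
  induction t generalizing S₀ with
  | zero =>
    rw [rpTrajProb, ← (Equiv.funUnique (Fin 1) (Config n)).symm.sum_comp]
    simp [Matrix.one_apply, allCooperate, ite_and]
  | succ t ih =>
    have hrhs : ∑ S, (rpMatrix p n ^ (t + 1)) S₀ S * allCooperate S =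
        ∑ T, rpStepProb p S₀ T * ∑ S, (rpMatrix p n ^ t) T S * allCooperate S := by
      simp only [pow_succ', Matrix.mul_apply, Finset.sum_mul, Finset.mul_sum]
      rw [Finset.sum_comm]
      simp only [rpMatrix, Matrix.of_apply, mul_assoc]
    rw [hrhs, rpTrajProb_succ]
    refine Finset.sum_congr rfl fun T _ => ?_
    rw [← ih T]
    by_cases hS : S₀ = fun _ => true
    · subst hS
      rw [rpStepProb_allCooperate]
      split_ifs with hT
      · congr 1
        refine rpTrajProb_congr p T t fun σ hσ => ⟨fun _ => ⟨0, hσ.trans hT⟩, fun _ => ⟨0, ?_⟩⟩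
        simp
      · simp
    · congr 1
      refine rpTrajProb_congr p T t fun σ _ => ?_
      simp [Fin.exists_fin_succ, hS]

end DistinctRuns

/-- **Slow convergence of Rational Pavlov for small `p`.**
There are constants `p₁ > 0` and `c > 0` such that for every `p ∈ (0, p₁]` and every
sufficiently large `n` (in particular `n ≥ e^{1/p}`): starting from the all-defect
configuration, the probability that the chain is in the all-cooperate configuration
at some time `t ≤ e^{c·n}` is at most `e^{-c·n}`. -/
theorem rp_slow_convergence :
    ∃ p₁ : ℝ, 0 < p₁ ∧ ∃ c : ℝ, 0 < c ∧
      ∀ p : ℝ, p ∈ Set.Ioc (0 : ℝ) p₁ →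
        ∀ (n : ℕ) [NeZero n], Real.exp (1 / p) ≤ (n : ℝ) →
          rpTrajProb p (n := n) (fun _ => false) ⌈Real.exp (c * n)⌉₊
            (fun σ => ∃ s : Fin (⌈Real.exp (c * n)⌉₊ + 1),
              (s : ℝ) ≤ Real.exp (c * n) ∧ σ s = fun _ => true)
          ≤ Real.exp (-(c * n)) := by
  refine ⟨1 / 128, by norm_num, 1, one_pos, ?_⟩
  rintro p ⟨hp, hp'⟩ n _ hn
  have hn3 : 3 ≤ n := by
    have h1 : (128 : ℝ) ≤ 1 / p := by
      rw [le_div_iff₀ hp]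
      linarith
    have h2 := Real.add_one_le_exp (1 / p)
    have h3 : (3 : ℝ) ≤ n := by linarith
    exact_mod_cast h3
  rw [one_mul]
  have hE := Real.exp_pos (n : ℝ)
  have hceil : (⌈Real.exp (n : ℝ)⌉₊ : ℝ) ≤ 2 * Real.exp n := by
    have h1 := Nat.ceil_lt_add_one hE.le
    have h2 := Real.one_le_exp (Nat.cast_nonneg n : (0 : ℝ) ≤ n)
    linarith
  have hsq : Real.exp (n : ℝ) * Real.exp n ≤ 8 ^ n := by
    have h1 : Real.exp (n : ℝ) = Real.exp 1 ^ n := by rw [← Real.exp_nat_mul, mul_one]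
    rw [h1, ← mul_pow]
    have h2 := Real.exp_one_lt_d9
    have h3 := Real.exp_pos 1
    exact pow_le_pow_left₀ (by positivity) (by nlinarith) n
  have hweight : arcWeight (n - 2) * 8 ^ n ≤ 64 := by
    have h1 := arcWeight_le (n - 2)
    have h2 : (8 : ℝ) ^ n = 8 ^ (n - 2) * 64 := by
      rw [show (64 : ℝ) = 8 ^ 2 by norm_num, ← pow_add, Nat.sub_add_cancel (by omega)]
    rw [h2, ← mul_assoc]
    have h3 : ((1 : ℝ) / 8) ^ (n - 2) * 8 ^ (n - 2) = 1 := by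
      rw [← mul_pow]
      norm_num
    have h4 : (0 : ℝ) < 8 ^ (n - 2) := by positivity
    nlinarith
  have hp2 : p ^ 2 ≤ 1 / 128 := by nlinarith
  have hw := arcWeight_pos (n - 2)
  rw [Real.exp_neg, ← one_div, le_div_iff₀ hE]
  calc _ ≤ (⌈Real.exp (n : ℝ)⌉₊ * (p ^ 2 * arcWeight (n - 2))) * Real.exp n := by
        refine mul_le_mul_of_nonneg_right ?_ hE.le
        refine (rpTrajProb_mono hp.le (by linarith) _ _
          fun σ h => h.imp fun s hs => hs.2).trans ?_
        rw [rpTrajProb_exists_eq]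
        exact sum_law_allCooperate_le hn3 hp.le hp' _
    _ ≤ (2 * Real.exp n * (1 / 128 * arcWeight (n - 2))) * Real.exp n := by gcongr
    _ = 1 / 64 * (arcWeight (n - 2) * (Real.exp n * Real.exp n)) := by ring
    _ ≤ 1 / 64 * (arcWeight (n - 2) * 8 ^ n) := by gcongr
    _ ≤ 1 := by linarith
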